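/- (Π¹₁-hardness of C_prec and C_prec^-.) There exists a primitive recursive function g : ℕ → ℕ such that for every a: a ∈ O if and only if g(a) ∈ C_prec, and a ∈ O if and only if g(a) ∈ C_prec^-. Hence Kleene's O is many-one reducible to C_prec and to C_prec^-. -/

import Mathlib

namespace Shoen

/-- Kleene application: value of the `e`-th partial recursive function at `n`,
in the standard numbering via `Nat.Partrec.Code`. -/
def peval (e n : ℕ) : Part ℕ := (Denumerable.ofNat Nat.Partrec.Code e).eval n

/-- `e` is an index of a (total) primitive recursive function. -/
def PrimIndex (e : ℕ) : Prop := ∃ f : ℕ → ℕ, Nat.Primrec f ∧ ∀ n, peval e n = Part.some (f n)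

/-- Kleene's relation `<_O`. -/
inductive KLt : ℕ → ℕ → Prop
  | base : KLt 1 2
  | step {a b : ℕ} : KLt a b → KLt b (2 ^ b)
  | lim {e : ℕ} (h : ∀ n, (peval e n).Dom)
      (hm : ∀ n, KLt ((peval e n).get (h n)) ((peval e (n + 1)).get (h (n + 1))))
      (n : ℕ) : KLt ((peval e n).get (h n)) (3 * 5 ^ e)
  | trans {a b c : ℕ} : KLt a b → KLt b c → KLt a c

/-- Kleene's `O`. -/
def KO (a : ℕ) : Prop := KLt a (2 ^ a)

/-- The auxiliary relation `<'_O`. -/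
inductive KLt' : ℕ → ℕ → Prop
  | base : KLt' 1 2
  | step {a b : ℕ} : KLt' a b → KLt' b (2 ^ b)
  | lim {e n x : ℕ} : x ∈ peval e n → KLt' x (3 * 5 ^ e)
  | trans {a b c : ℕ} : KLt' a b → KLt' b c → KLt' a c

/-- The inductive characterization `O'` of Kleene's `O`. -/
inductive KO' : ℕ → Prop
  | one : KO' 1
  | step {a : ℕ} : KO' a → KO' (2 ^ a)
  | lim {e : ℕ} (h : ∀ n, (peval e n).Dom)
      (hm : ∀ n, KLt' ((peval e n).get (h n)) ((peval e (n + 1)).get (h (n + 1)))) :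
      KO' (3 * 5 ^ e)



/-! ### Syntax of first order arithmetic (negation normal form) -/

/-- Terms of the language `0,1,+,×,=`, with de Bruijn variables. -/
inductive Trm : Type
  | var : ℕ → Trm
  | zero : Trm
  | one : Trm
  | add : Trm → Trm → Trm
  | mul : Trm → Trm → Trm
deriving DecidableEq

/-- Formulas in negation normal form: literals (atomic and negated atomic
formulas) combined by `∧, ∨, ∀, ∃` (de Bruijn binders). -/
inductive Fml : Type
  | eq : Trm → Trm → Fml
  | ne : Trm → Trm → Fml
  | and : Fml → Fml → Fml
  | or : Fml → Fml → Fml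
  | all : Fml → Fml
  | ex : Fml → Fml
deriving DecidableEq

/-- All free variables of a term are `< k`. -/
def Trm.cu : Trm → ℕ → Bool
  | .var i, k => decide (i < k)
  | .zero, _ => true
  | .one, _ => true
  | .add s t, k => s.cu k && t.cu k
  | .mul s t, k => s.cu k && t.cu k

/-- All free variables of a formula are `< k`. -/
def Fml.cu : Fml → ℕ → Bool
  | .eq s t, k => s.cu k && t.cu k
  | .ne s t, k => s.cu k && t.cu k
  | .and A B, k => A.cu k && B.cu k
  | .or A B, k => A.cu k && B.cu k
  | .all A, k => A.cu (k + 1)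
  | .ex A, k => A.cu (k + 1)

/-- A sentence is a closed formula. -/
abbrev Sentence : Type := { A : Fml // A.cu 0 = true }

/-- Value of a term under an environment. -/
def Trm.val (ρ : ℕ → ℕ) : Trm → ℕ
  | .var i => ρ i
  | .zero => 0
  | .one => 1
  | .add s t => s.val ρ + t.val ρ
  | .mul s t => s.val ρ * t.val ρ

/-- Extend an environment by a value for variable `0`. -/
def consEnv (n : ℕ) (ρ : ℕ → ℕ) : ℕ → ℕ
  | 0 => n
  | k + 1 => ρ k

/-- Satisfaction in the standard model `ℕ`. -/
def Fml.Sat (ρ : ℕ → ℕ) : Fml → Prop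
  | .eq s t => s.val ρ = t.val ρ
  | .ne s t => s.val ρ ≠ t.val ρ
  | .and A B => A.Sat ρ ∧ B.Sat ρ
  | .or A B => A.Sat ρ ∨ B.Sat ρ
  | .all A => ∀ n : ℕ, A.Sat (consEnv n ρ)
  | .ex A => ∃ n : ℕ, A.Sat (consEnv n ρ)

/-- Truth of a sentence in the standard model. -/
def sentTrue (A : Sentence) : Prop := A.1.Sat (fun _ => 0)

/-- Substitution of a closed term `t` for variable `k` in a term. -/
def Trm.sub (t : Trm) (k : ℕ) : Trm → Trm
  | .var i => if i = k then t else if k < i then .var (i - 1) else .var i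
  | .zero => .zero
  | .one => .one
  | .add s u => .add (Trm.sub t k s) (Trm.sub t k u)
  | .mul s u => .mul (Trm.sub t k s) (Trm.sub t k u)

/-- Substitution of a closed term `t` for variable `k` in a formula. -/
def Fml.sub (t : Trm) : Fml → ℕ → Fml
  | .eq s u, k => .eq (Trm.sub t k s) (Trm.sub t k u)
  | .ne s u, k => .ne (Trm.sub t k s) (Trm.sub t k u)
  | .and A B, k => .and (A.sub t k) (B.sub t k)
  | .or A B, k => .or (A.sub t k) (B.sub t k)
  | .all A, k => .all (A.sub t (k + 1))
  | .ex A, k => .ex (A.sub t (k + 1))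

/-- The numeral `n̄`. -/
def numeral : ℕ → Trm
  | 0 => .zero
  | n + 1 => .add (numeral n) .one

theorem Trm.cu_mono : ∀ (t : Trm) {j k : ℕ}, j ≤ k → t.cu j = true → t.cu k = true := by
  intro t
  induction t with
  | var i =>
    intro j k h ht
    simp only [Trm.cu, decide_eq_true_eq] at *
    omega
  | zero => intros; rfl
  | one => intros; rfl
  | add s u ihs ihu =>
    intro j k h ht
    simp only [Trm.cu, Bool.and_eq_true] at *
    exact ⟨ihs h ht.1, ihu h ht.2⟩
  | mul s u ihs ihu =>
    intro j k h ht
    simp only [Trm.cu, Bool.and_eq_true] at *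
    exact ⟨ihs h ht.1, ihu h ht.2⟩

theorem Trm.cu_sub : ∀ (s : Trm) {k : ℕ} {t : Trm},
    t.cu 0 = true → s.cu (k + 1) = true → (Trm.sub t k s).cu k = true := by
  intro s
  induction s with
  | var i =>
    intro k t ht hs
    simp only [Trm.cu, decide_eq_true_eq] at hs
    simp only [Trm.sub]
    by_cases h : i = k
    · rw [if_pos h]
      exact Trm.cu_mono t (Nat.zero_le k) ht
    · have h2 : ¬ k < i := by omega
      rw [if_neg h, if_neg h2]
      simp only [Trm.cu, decide_eq_true_eq]
      omega
  | zero => intros; rfl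
  | one => intros; rfl
  | add s u ihs ihu =>
    intro k t ht hs
    simp only [Trm.cu, Bool.and_eq_true] at hs
    simp only [Trm.sub, Trm.cu, Bool.and_eq_true]
    exact ⟨ihs ht hs.1, ihu ht hs.2⟩
  | mul s u ihs ihu =>
    intro k t ht hs
    simp only [Trm.cu, Bool.and_eq_true] at hs
    simp only [Trm.sub, Trm.cu, Bool.and_eq_true]
    exact ⟨ihs ht hs.1, ihu ht hs.2⟩

theorem Fml.cu_sub : ∀ (A : Fml) {k : ℕ} {t : Trm},
    t.cu 0 = true → A.cu (k + 1) = true → (A.sub t k).cu k = true := by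
  intro A
  induction A with
  | eq s u =>
    intro k t ht hA
    simp only [Fml.cu, Bool.and_eq_true] at hA
    simp only [Fml.sub, Fml.cu, Bool.and_eq_true]
    exact ⟨Trm.cu_sub s ht hA.1, Trm.cu_sub u ht hA.2⟩
  | ne s u =>
    intro k t ht hA
    simp only [Fml.cu, Bool.and_eq_true] at hA
    simp only [Fml.sub, Fml.cu, Bool.and_eq_true]
    exact ⟨Trm.cu_sub s ht hA.1, Trm.cu_sub u ht hA.2⟩
  | and A B ihA ihB =>
    intro k t ht h
    simp only [Fml.cu, Bool.and_eq_true] at h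
    simp only [Fml.sub, Fml.cu, Bool.and_eq_true]
    exact ⟨ihA ht h.1, ihB ht h.2⟩
  | or A B ihA ihB =>
    intro k t ht h
    simp only [Fml.cu, Bool.and_eq_true] at h
    simp only [Fml.sub, Fml.cu, Bool.and_eq_true]
    exact ⟨ihA ht h.1, ihB ht h.2⟩
  | all A ihA =>
    intro k t ht h
    simp only [Fml.cu] at h
    simp only [Fml.sub, Fml.cu]
    exact ihA ht h
  | ex A ihA =>
    intro k t ht h
    simp only [Fml.cu] at h
    simp only [Fml.sub, Fml.cu]
    exact ihA ht h

theorem numeral_cu : ∀ n : ℕ, (numeral n).cu 0 = true := by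
  intro n
  induction n with
  | zero => rfl
  | succ n ih => simp [numeral, Trm.cu, ih]

/-- Negation (de Morgan dual) of a formula in negation normal form. -/
def Fml.neg : Fml → Fml
  | .eq s t => .ne s t
  | .ne s t => .eq s t
  | .and A B => .or A.neg B.neg
  | .or A B => .and A.neg B.neg
  | .all A => .ex A.neg
  | .ex A => .all A.neg

theorem Fml.cu_neg : ∀ (A : Fml) {k : ℕ}, A.cu k = true → A.neg.cu k = true := by
  intro A
  induction A with
  | eq s u => intro k h; simpa [Fml.cu, Fml.neg] using h
  | ne s u => intro k h; simpa [Fml.cu, Fml.neg] using h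
  | and A B ihA ihB =>
    intro k h
    simp only [Fml.cu, Bool.and_eq_true] at h
    simp only [Fml.neg, Fml.cu, Bool.and_eq_true]
    exact ⟨ihA h.1, ihB h.2⟩
  | or A B ihA ihB =>
    intro k h
    simp only [Fml.cu, Bool.and_eq_true] at h
    simp only [Fml.neg, Fml.cu, Bool.and_eq_true]
    exact ⟨ihA h.1, ihB h.2⟩
  | all A ihA =>
    intro k h
    simp only [Fml.cu] at h
    simp only [Fml.neg, Fml.cu]
    exact ihA h
  | ex A ihA =>
    intro k h
    simp only [Fml.cu] at h
    simp only [Fml.neg, Fml.cu]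
    exact ihA h

/-- Conjunction of sentences. -/
def sAnd (A B : Sentence) : Sentence :=
  ⟨.and A.1 B.1, by simp [Fml.cu, A.2, B.2]⟩

/-- Disjunction of sentences. -/
def sOr (A B : Sentence) : Sentence :=
  ⟨.or A.1 B.1, by simp [Fml.cu, A.2, B.2]⟩

/-- Negation of a sentence. -/
def sNeg (A : Sentence) : Sentence := ⟨A.1.neg, Fml.cu_neg A.1 A.2⟩

/-- The sentence `∀x A(x)`, for `A` with (at most) one free variable. -/
def sAll (A : Fml) (h : A.cu 1 = true) : Sentence := ⟨.all A, by simpa [Fml.cu] using h⟩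

/-- The sentence `∃x A(x)`, for `A` with (at most) one free variable. -/
def sEx (A : Fml) (h : A.cu 1 = true) : Sentence := ⟨.ex A, by simpa [Fml.cu] using h⟩

/-- The instance `A(n̄)` of a formula `A` with one free variable. -/
def sInst (A : Fml) (h : A.cu 1 = true) (n : ℕ) : Sentence :=
  ⟨A.sub (numeral n) 0, Fml.cu_sub A (numeral_cu n) h⟩

/-- Literals: atomic and negated atomic formulas. -/
def Fml.isLiteral : Fml → Bool
  | .eq _ _ => true
  | .ne _ _ => true
  | _ => false

/-- Quantifier free formulas. -/
def Fml.qf : Fml → Bool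
  | .eq _ _ => true
  | .ne _ _ => true
  | .and A B => A.qf && B.qf
  | .or A B => A.qf && B.qf
  | .all _ => false
  | .ex _ => false

/-- An axiom is a sequent containing a true closed literal. -/
def IsAxiom (Γ : Finset Sentence) : Prop :=
  ∃ A ∈ Γ, A.1.isLiteral = true ∧ sentTrue A

/-- A sequent is true if some member is true. -/
def SeqTrue (Γ : Finset Sentence) : Prop := ∃ A ∈ Γ, sentTrue A


/-! ### A primitive recursive Gödel numbering of terms, sentences and sequents -/

/-- Gödel number of a term. -/
def Trm.enc : Trm → ℕ
  | .var i => 5 * i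
  | .zero => 1
  | .one => 2
  | .add s t => 5 * Nat.pair s.enc t.enc + 3
  | .mul s t => 5 * Nat.pair s.enc t.enc + 4

/-- Fuelled decoding of terms. -/
def Trm.dec : ℕ → ℕ → Option Trm
  | 0, _ => none
  | fuel + 1, n =>
    if n % 5 = 0 then some (.var (n / 5))
    else if n % 5 = 1 then some .zero
    else if n % 5 = 2 then some .one
    else if n % 5 = 3 then
      match Trm.dec fuel (n / 5).unpair.1, Trm.dec fuel (n / 5).unpair.2 with
      | some s, some t => some (.add s t)
      | _, _ => none
    else
      match Trm.dec fuel (n / 5).unpair.1, Trm.dec fuel (n / 5).unpair.2 with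
      | some s, some t => some (.mul s t)
      | _, _ => none

theorem Trm.dec_enc : ∀ (t : Trm) (fuel : ℕ), t.enc < fuel → Trm.dec fuel t.enc = some t := by
  intro t
  induction t with
  | var i =>
    intro fuel h
    match fuel with
    | f + 1 =>
      have h0 : (5 * i) % 5 = 0 := by omega
      have h1 : (5 * i) / 5 = i := by omega
      simp [Trm.dec, Trm.enc, h0, h1]
  | zero =>
    intro fuel h
    match fuel with
    | f + 1 => simp [Trm.dec, Trm.enc]
  | one =>
    intro fuel h
    match fuel with
    | f + 1 => simp [Trm.dec, Trm.enc]
  | add s u ihs ihu =>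
    intro fuel h
    match fuel with
    | f + 1 =>
      simp only [Trm.enc] at h ⊢
      set p := Nat.pair s.enc u.enc with hp
      have h0 : (5 * p + 3) % 5 = 3 := by omega
      have h1 : (5 * p + 3) / 5 = p := by omega
      have hs : s.enc < f := by
        have := Nat.left_le_pair s.enc u.enc
        omega
      have hu : u.enc < f := by
        have := Nat.right_le_pair s.enc u.enc
        omega
      simp only [Trm.dec, h0, h1]
      rw [hp, Nat.unpair_pair, ihs f hs, ihu f hu]
      simp
  | mul s u ihs ihu =>
    intro fuel h
    match fuel with
    | f + 1 =>
      simp only [Trm.enc] at h ⊢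
      set p := Nat.pair s.enc u.enc with hp
      have h0 : (5 * p + 4) % 5 = 4 := by omega
      have h1 : (5 * p + 4) / 5 = p := by omega
      have hs : s.enc < f := by
        have := Nat.left_le_pair s.enc u.enc
        omega
      have hu : u.enc < f := by
        have := Nat.right_le_pair s.enc u.enc
        omega
      simp only [Trm.dec, h0, h1]
      rw [hp, Nat.unpair_pair, ihs f hs, ihu f hu]
      simp

instance : Encodable Trm :=
  ⟨Trm.enc, fun n => Trm.dec (n + 1) n, fun t => Trm.dec_enc t _ (Nat.lt_succ_self _)⟩

/-- Gödel number of a formula. -/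
def Fml.enc : Fml → ℕ
  | .eq s t => 6 * Nat.pair s.enc t.enc
  | .ne s t => 6 * Nat.pair s.enc t.enc + 1
  | .and A B => 6 * Nat.pair A.enc B.enc + 2
  | .or A B => 6 * Nat.pair A.enc B.enc + 3
  | .all A => 6 * A.enc + 4
  | .ex A => 6 * A.enc + 5

/-- Fuelled decoding of formulas. -/
def Fml.dec : ℕ → ℕ → Option Fml
  | 0, _ => none
  | fuel + 1, n =>
    if n % 6 = 0 then
      match Encodable.decode (α := Trm) (n / 6).unpair.1,
            Encodable.decode (α := Trm) (n / 6).unpair.2 with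
      | some s, some t => some (.eq s t)
      | _, _ => none
    else if n % 6 = 1 then
      match Encodable.decode (α := Trm) (n / 6).unpair.1,
            Encodable.decode (α := Trm) (n / 6).unpair.2 with
      | some s, some t => some (.ne s t)
      | _, _ => none
    else if n % 6 = 2 then
      match Fml.dec fuel (n / 6).unpair.1, Fml.dec fuel (n / 6).unpair.2 with
      | some A, some B => some (.and A B)
      | _, _ => none
    else if n % 6 = 3 then
      match Fml.dec fuel (n / 6).unpair.1, Fml.dec fuel (n / 6).unpair.2 with
      | some A, some B => some (.or A B)
      | _, _ => none
    else if n % 6 = 4 then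
      match Fml.dec fuel (n / 6) with
      | some A => some (.all A)
      | none => none
    else
      match Fml.dec fuel (n / 6) with
      | some A => some (.ex A)
      | none => none

theorem Fml.dec_enc : ∀ (A : Fml) (fuel : ℕ), A.enc < fuel → Fml.dec fuel A.enc = some A := by
  intro A
  induction A with
  | eq s u =>
    intro fuel h
    match fuel with
    | f + 1 =>
      simp only [Fml.enc] at h ⊢
      set p := Nat.pair s.enc u.enc with hp
      have h0 : (6 * p) % 6 = 0 := by omega
      have h1 : (6 * p) / 6 = p := by omega
      have hds : Encodable.decode (α := Trm) s.enc = some s := Encodable.encodek s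
      have hdu : Encodable.decode (α := Trm) u.enc = some u := Encodable.encodek u
      simp only [Fml.dec, h0, h1]
      rw [hp, Nat.unpair_pair, hds, hdu]
      simp
  | ne s u =>
    intro fuel h
    match fuel with
    | f + 1 =>
      simp only [Fml.enc] at h ⊢
      set p := Nat.pair s.enc u.enc with hp
      have h0 : (6 * p + 1) % 6 = 1 := by omega
      have h1 : (6 * p + 1) / 6 = p := by omega
      have hds : Encodable.decode (α := Trm) s.enc = some s := Encodable.encodek s
      have hdu : Encodable.decode (α := Trm) u.enc = some u := Encodable.encodek u
      simp only [Fml.dec, h0, h1]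
      rw [hp, Nat.unpair_pair, hds, hdu]
      simp
  | and A B ihA ihB =>
    intro fuel h
    match fuel with
    | f + 1 =>
      simp only [Fml.enc] at h ⊢
      set p := Nat.pair A.enc B.enc with hp
      have h0 : (6 * p + 2) % 6 = 2 := by omega
      have h1 : (6 * p + 2) / 6 = p := by omega
      have hA : A.enc < f := by
        have := Nat.left_le_pair A.enc B.enc
        omega
      have hB : B.enc < f := by
        have := Nat.right_le_pair A.enc B.enc
        omega
      simp only [Fml.dec, h0, h1]
      rw [hp, Nat.unpair_pair, ihA f hA, ihB f hB]
      simp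
  | or A B ihA ihB =>
    intro fuel h
    match fuel with
    | f + 1 =>
      simp only [Fml.enc] at h ⊢
      set p := Nat.pair A.enc B.enc with hp
      have h0 : (6 * p + 3) % 6 = 3 := by omega
      have h1 : (6 * p + 3) / 6 = p := by omega
      have hA : A.enc < f := by
        have := Nat.left_le_pair A.enc B.enc
        omega
      have hB : B.enc < f := by
        have := Nat.right_le_pair A.enc B.enc
        omega
      simp only [Fml.dec, h0, h1]
      rw [hp, Nat.unpair_pair, ihA f hA, ihB f hB]
      simp
  | all A ihA =>
    intro fuel h
    match fuel with
    | f + 1 =>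
      simp only [Fml.enc] at h ⊢
      have h0 : (6 * A.enc + 4) % 6 = 4 := by omega
      have h1 : (6 * A.enc + 4) / 6 = A.enc := by omega
      have hA : A.enc < f := by omega
      simp [Fml.dec, h0, h1, ihA f hA]
  | ex A ihA =>
    intro fuel h
    match fuel with
    | f + 1 =>
      simp only [Fml.enc] at h ⊢
      have h0 : (6 * A.enc + 5) % 6 = 5 := by omega
      have h1 : (6 * A.enc + 5) / 6 = A.enc := by omega
      have hA : A.enc < f := by omega
      simp [Fml.dec, h0, h1, ihA f hA]

instance : Encodable Fml :=
  ⟨Fml.enc, fun n => Fml.dec (n + 1) n, fun A => Fml.dec_enc A _ (Nat.lt_succ_self _)⟩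

/-- Gödel number of a sentence. -/
def encF (A : Sentence) : ℕ := Encodable.encode A

/-- Gödel number of a sequent (finite set of sentences). -/
def encS (Γ : Finset Sentence) : ℕ := Encodable.encode Γ

/-- Decode a Gödel number into a sentence (with a default value). -/
def decF (n : ℕ) : Sentence := (Encodable.decode (α := Sentence) n).getD ⟨.eq .zero .zero, rfl⟩

/-- Decode a Gödel number into a sequent (with a default value). -/
def decS (n : ℕ) : Finset Sentence := (Encodable.decode (α := Finset Sentence) n).getD ∅

/-! ### Tupling of natural numbers, with projections -/

/-- Code of a finite sequence (tuple) of natural numbers; codes are nonzero. -/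
def tup (l : List ℕ) : ℕ := Encodable.encode l + 1

/-- The finite sequence coded by a natural number. -/
def untup (a : ℕ) : List ℕ := Denumerable.ofNat (List ℕ) (a - 1)

/-- The `i`-th projection `(a)_i`. -/
def proj (a i : ℕ) : ℕ := (untup a).getD i 0

/-- `a` codes a finite sequence (every nonzero number does, bijectively). -/
def InSeq (a : ℕ) : Prop := a ≠ 0

/-- The code of the empty sequence `⟨⟩` (the root). -/
def rootSeq : ℕ := tup []

/-- The code of `σ⌢i`. -/
def snoc (σ i : ℕ) : ℕ := tup (untup σ ++ [i])

/-! ### Names for the inference rules -/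

def axC : ℕ := 1
def andC : ℕ := 2
def orC : ℕ := 3
def omC : ℕ := 4
def exC : ℕ := 5
def cutC : ℕ := 6
def omrepC : ℕ := 7

/-- The end sequent of a (code of a) proof or proof node: `(a)_1` if the rule
`(a)_0` carries no main formula, and `(a)_1 ∪ {(a)_2}` otherwise. -/
def EndS (a : ℕ) : Finset Sentence :=
  if proj a 0 = cutC ∨ proj a 0 = axC ∨ proj a 0 = omrepC then decS (proj a 1)
  else decS (proj a 1) ∪ {decF (proj a 2)}

/-! ### Local codes of ω-proofs -/

/-- Local codes of `ω`-proofs, in Tait style.  The three `Bool` parameters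
respectively allow the cut rule, restrict the `ω`-rule to indices of primitive
recursive functions, and allow the vacuous `ω`-repetition rule. -/
inductive CGen (c p r : Bool) : ℕ → Prop
  | ax (Γ : Finset Sentence) (h : IsAxiom Γ) : CGen c p r (tup [axC, encS Γ])
  | and {a b : ℕ} (Γ : Finset Sentence) (A B : Sentence)
      (ha : CGen c p r a) (hb : CGen c p r b)
      (ea : EndS a = Γ ∪ {A}) (eb : EndS b = Γ ∪ {B}) :
      CGen c p r (tup [andC, encS Γ, encF (sAnd A B), a, b])
  | or {a : ℕ} (Γ : Finset Sentence) (A B : Sentence) (ha : CGen c p r a)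
      (ea : EndS a = Γ ∪ {A, B}) :
      CGen c p r (tup [orC, encS Γ, encF (sOr A B), a])
  | om {e : ℕ} (Γ : Finset Sentence) (A : Fml) (hA : A.cu 1 = true)
      (hp : p = true → PrimIndex e)
      (htot : ∀ n, (peval e n).Dom)
      (hmem : ∀ n, CGen c p r ((peval e n).get (htot n)))
      (hend : ∀ n, EndS ((peval e n).get (htot n)) = Γ ∪ {sInst A hA n}) :
      CGen c p r (tup [omC, encS Γ, encF (sAll A hA), e])
  | ex {a : ℕ} (Γ : Finset Sentence) (A : Fml) (hA : A.cu 1 = true) (n : ℕ)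
      (ha : CGen c p r a) (ea : EndS a = Γ ∪ {sInst A hA n}) :
      CGen c p r (tup [exC, encS Γ, encF (sEx A hA), a])
  | cut {a b : ℕ} (hc : c = true) (Γ : Finset Sentence) (C : Sentence)
      (ha : CGen c p r a) (hb : CGen c p r b)
      (ea : EndS a = Γ ∪ {C}) (eb : EndS b = Γ ∪ {sNeg C}) :
      CGen c p r (tup [cutC, encS Γ, encF C, a, b])
  | omrep {e : ℕ} (hr : r = true) (Γ : Finset Sentence) (hp : PrimIndex e)
      (htot : ∀ n, (peval e n).Dom)
      (hmem : ∀ n, CGen c p r ((peval e n).get (htot n)))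
      (hend : ∀ n, EndS ((peval e n).get (htot n)) = Γ) :
      CGen c p r (tup [omrepC, encS Γ, e])

/-- `C_rec`: recursive local codes of `ω`-proofs. -/
def Crec : ℕ → Prop := CGen true false false

/-- `C_rec^-`: the cut free fragment of `C_rec`. -/
def CrecM : ℕ → Prop := CGen false false false

/-- `C_prec`: primitive recursive local codes of `ω`-proofs. -/
def Cprec : ℕ → Prop := CGen true true false

/-- `C_prec^-`: the cut free fragment of `C_prec`. -/
def CprecM : ℕ → Prop := CGen false true false

/-- `C_prec^{ω-rep}`: `C_prec` with the vacuous `ω`-repetition rule. -/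
def CprecRep : ℕ → Prop := CGen true true true

/-! ### ω-proofs as well founded trees of sequents -/

/-- `σ` is a node of the tree `T_π = {σ ∈ Seq : π(σ) ∈ Seq}`. -/
def TreeOf (π : ℕ → ℕ) (σ : ℕ) : Prop := σ ≠ 0 ∧ π σ ≠ 0

/-- The tree `T_π` is well founded: it has no infinite branch. -/
def WFTree (π : ℕ → ℕ) : Prop :=
  ¬ ∃ f : ℕ → ℕ, ∀ n : ℕ, TreeOf π (tup ((List.range n).map f))

/-- The inference at an inner node of an `ω`-proof is a correct instance of one
of the rules of Tait-style `ω`-arithmetic. -/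
def CorrectInner (π : ℕ → ℕ) (σ : ℕ) : Prop :=
  (∃ (Γ : Finset Sentence) (A B : Sentence),
    π σ = tup [andC, encS Γ, encF (sAnd A B)] ∧
    TreeOf π (snoc σ 0) ∧ TreeOf π (snoc σ 1) ∧ ¬ TreeOf π (snoc σ 2) ∧
    EndS (π (snoc σ 0)) = Γ ∪ {A} ∧ EndS (π (snoc σ 1)) = Γ ∪ {B}) ∨
  (∃ (Γ : Finset Sentence) (A B : Sentence),
    π σ = tup [orC, encS Γ, encF (sOr A B)] ∧
    TreeOf π (snoc σ 0) ∧ ¬ TreeOf π (snoc σ 1) ∧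
    EndS (π (snoc σ 0)) = Γ ∪ {A, B}) ∨
  (∃ (Γ : Finset Sentence) (A : Fml) (hA : A.cu 1 = true),
    π σ = tup [omC, encS Γ, encF (sAll A hA)] ∧
    (∀ n : ℕ, TreeOf π (snoc σ n)) ∧
    (∀ n : ℕ, EndS (π (snoc σ n)) = Γ ∪ {sInst A hA n})) ∨
  (∃ (Γ : Finset Sentence) (A : Fml) (hA : A.cu 1 = true) (n : ℕ),
    π σ = tup [exC, encS Γ, encF (sEx A hA)] ∧
    TreeOf π (snoc σ 0) ∧ ¬ TreeOf π (snoc σ 1) ∧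
    EndS (π (snoc σ 0)) = Γ ∪ {sInst A hA n}) ∨
  (∃ (Γ : Finset Sentence) (C : Sentence),
    π σ = tup [cutC, encS Γ, encF C] ∧
    TreeOf π (snoc σ 0) ∧ TreeOf π (snoc σ 1) ∧ ¬ TreeOf π (snoc σ 2) ∧
    EndS (π (snoc σ 0)) = Γ ∪ {C} ∧ EndS (π (snoc σ 1)) = Γ ∪ {sNeg C})

/-- Local correctness of a function `π : ℕ → ℕ` viewed as a tree of sequents:
all conditions in the definition of `ω`-proof except well-foundedness. -/
structure LocallyCorrect (π : ℕ → ℕ) : Prop where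
  /-- values outside `Seq` are `0` -/
  nonseq : ∀ σ, ¬ InSeq (π σ) → π σ = 0
  /-- `T_π` is closed under initial segments -/
  downward : ∀ σ τ, TreeOf π σ → τ ≠ 0 → untup τ <+: untup σ → TreeOf π τ
  /-- children come first -/
  mono : ∀ σ i j, i < j → TreeOf π (snoc σ j) → TreeOf π (snoc σ i)
  /-- top nodes are axioms -/
  top : ∀ σ, TreeOf π σ → ¬ TreeOf π (snoc σ 0) →
    ∃ Γ : Finset Sentence, IsAxiom Γ ∧ π σ = tup [axC, encS Γ]
  /-- inner nodes are correct inferences -/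
  inner : ∀ σ, TreeOf π σ → TreeOf π (snoc σ 0) → CorrectInner π σ

/-- `π : ℕ → ℕ` is an `ω`-proof. -/
structure IsOmegaProof (π : ℕ → ℕ) extends LocallyCorrect π : Prop where
  /-- the tree `T_π` is well founded -/
  wf : WFTree π

/-- An `ω`-proof is cut free if no node is labelled `cut`. -/
def CutFree (π : ℕ → ℕ) : Prop := ∀ σ, TreeOf π σ → proj (π σ) 0 ≠ cutC

/-! ### The ω-proof `π(a)` coded by a local code `a` -/

open Classical in
/-- The code of the subproof at child `n` of the proof coded by `a`. -/
noncomputable def childCode (a n : ℕ) : ℕ :=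
  if proj a 0 = omC then
    (if h : (peval (proj a 3) n).Dom then (peval (proj a 3) n).get h else 0)
  else if proj a 0 = andC ∨ proj a 0 = orC ∨ proj a 0 = exC ∨ proj a 0 = cutC then
    proj a (n + 3)
  else 0

/-- Walk down a local code along a path. -/
noncomputable def walkCode (a : ℕ) : List ℕ → ℕ
  | [] => a
  | i :: l => walkCode (childCode a i) l

/-- The node label `⟨R,Γ,A⟩` (or `⟨Ax,Γ⟩`) determined by a local code. -/
def nodeVal (b : ℕ) : ℕ :=
  if proj b 0 = axC then tup [axC, proj b 1]
  else if proj b 0 = andC ∨ proj b 0 = orC ∨ proj b 0 = omC ∨ proj b 0 = exC ∨ proj b 0 = cutC then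
    tup [proj b 0, proj b 1, proj b 2]
  else 0

/-- The `ω`-proof `π(a)` determined by a local code `a` (with value `0` at all
other arguments). -/
noncomputable def piOf (a : ℕ) (σ : ℕ) : ℕ :=
  if σ = 0 then 0 else nodeVal (walkCode a (untup σ))

/-! ### Indices (global codes) of recursive and primitive recursive ω-proofs -/

/-- `I_rec`: `a` is an index of a recursive `ω`-proof. -/
def Irec (a : ℕ) : Prop :=
  ∃ h : ∀ n, (peval a n).Dom, IsOmegaProof (fun n => (peval a n).get (h n))

/-- `I_prec`: `a` is an index of a primitive recursive `ω`-proof. -/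
def Iprec (a : ℕ) : Prop :=
  ∃ f : ℕ → ℕ, Nat.Primrec f ∧ (∀ n, peval a n = Part.some (f n)) ∧ IsOmegaProof f

/-- `I_prec^-`: `a` is an index of a primitive recursive cut free `ω`-proof. -/
def IprecM (a : ℕ) : Prop :=
  ∃ f : ℕ → ℕ, Nat.Primrec f ∧ (∀ n, peval a n = Part.some (f n)) ∧
    IsOmegaProof f ∧ CutFree f

/-! ### Ordinal lengths -/

open Classical in
/-- `x + 1` if `P` holds, and `0` otherwise. -/
noncomputable def succIf (P : Prop) (x : Ordinal.{0}) : Ordinal.{0} :=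
  if P then x + 1 else 0

/-- The ordinal rank of a node of the tree `T_π`:
`rank σ = sup {rank (σ⌢i) + 1 : σ⌢i ∈ T_π}`. -/
inductive NodeRank (π : ℕ → ℕ) : ℕ → Ordinal.{0} → Prop
  | mk (σ : ℕ) (o : ℕ → Ordinal.{0})
      (h : ∀ i, TreeOf π (snoc σ i) → NodeRank π (snoc σ i) (o i)) :
      NodeRank π σ (⨆ i, succIf (TreeOf π (snoc σ i)) (o i))

/-- The ordinal length of a local code:  `|⟨Ax,Γ⟩| = 0`,
`|⟨R,Γ,A,a₁,…,a_k⟩| = sup{|a₁|,…,|a_k|} + 1`, and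
`|⟨ω,Γ,∀xA(x),e⟩| = sup{|⟨e⟩(n)| + 1 : n ∈ ℕ}`. -/
inductive CLen : ℕ → Ordinal.{0} → Prop
  | ax (g : ℕ) : CLen (tup [axC, g]) 0
  | one (R g x a : ℕ) (o : Ordinal.{0}) (hR : R = orC ∨ R = exC) (h : CLen a o) :
      CLen (tup [R, g, x, a]) (o + 1)
  | two (R g x a b : ℕ) (oa ob : Ordinal.{0}) (hR : R = andC ∨ R = cutC)
      (ha : CLen a oa) (hb : CLen b ob) :
      CLen (tup [R, g, x, a, b]) ((oa ⊔ ob) + 1)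
  | om (g x e : ℕ) (h : ∀ n, (peval e n).Dom) (o : ℕ → Ordinal.{0})
      (ho : ∀ n, CLen ((peval e n).get (h n)) (o n)) :
      CLen (tup [omC, g, x, e]) (⨆ n, o n + 1)

/-- The ordinal `|a|` of a notation `a ∈ O`:  `|1| = 0`, `|2^a| = |a| + 1`,
`|3·5^e| = sup{|⟨e⟩(n)| : n ∈ ℕ}`. -/
inductive KOrd : ℕ → Ordinal.{0} → Prop
  | one : KOrd 1 0
  | step {a : ℕ} {o : Ordinal.{0}} : KOrd a o → KOrd (2 ^ a) (o + 1)
  | lim {e : ℕ} (h : ∀ n, (peval e n).Dom) (o : ℕ → Ordinal.{0})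
      (ho : ∀ n, KOrd ((peval e n).get (h n)) (o n)) :
      KOrd (3 * 5 ^ e) (⨆ n, o n)


open Classical in
/-- One step of the sequence `a(f)` determined by a local code. -/
noncomputable def branchStep (b k : ℕ) : Option ℕ :=
  if (∃ (Γ : Finset Sentence) (A B : Sentence) (b₀ b₁ : ℕ),
        b = tup [andC, encS Γ, encF (sAnd A B), b₀, b₁]) ∨
     (∃ (Γ : Finset Sentence) (C : Sentence) (b₀ b₁ : ℕ),
        b = tup [cutC, encS Γ, encF C, b₀, b₁]) then
    some (proj b (3 + k % 2))
  else if ∃ (Γ : Finset Sentence) (A B : Sentence) (c : ℕ),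
      b = tup [orC, encS Γ, encF (sOr A B), c] then
    some (proj b 3)
  else if ∃ (Γ : Finset Sentence) (A : Fml) (hA : A.cu 1 = true) (e : ℕ),
      b = tup [omC, encS Γ, encF (sAll A hA), e] then
    (if h : (peval (proj b 3) k).Dom then some ((peval (proj b 3) k).get h) else none)
  else none

/-- The sequence `a(f) = ⟨a₀,a₁,…⟩`:  `chain a f i = some aᵢ` if the `i`-th
element of the sequence is defined, and `none` otherwise. -/
noncomputable def chain (a : ℕ) (f : ℕ → ℕ) : ℕ → Option ℕ
  | 0 => some a
  | i + 1 =>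
    match chain a f i with
    | none => none
    | some b => branchStep b (f i)

/-! ### An inductive characterization of `O` -/

/-- Stage-bounded Kleene application. -/
def pevaln (f e n : ℕ) : Option ℕ := (Denumerable.ofNat Nat.Partrec.Code e).evaln f n

theorem mem_peval_iff {e n x : ℕ} : x ∈ peval e n ↔ ∃ f, pevaln f e n = some x :=
  Nat.Partrec.Code.evaln_complete

theorem pevaln_mono {f f' e n x : ℕ} (hf : f ≤ f') (h : pevaln f e n = some x) :
    pevaln f' e n = some x :=
  Nat.Partrec.Code.evaln_mono hf h

theorem two_pow_ne_three_mul_five_pow (a b : ℕ) : 2 ^ a ≠ 3 * 5 ^ b := by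
  intro h
  have h3 : 3 ∣ 2 ^ a := h ▸ Dvd.intro _ rfl
  have := Nat.prime_three.dvd_of_dvd_pow h3
  omega

theorem three_mul_five_pow_inj {a b : ℕ} (h : 3 * 5 ^ a = 3 * 5 ^ b) : a = b :=
  Nat.pow_right_injective (by norm_num : 2 ≤ 5)
    (Nat.eq_of_mul_eq_mul_left (by norm_num) h)

/-- An immediate predecessor of `b`, selected by a hint `(c, n, f)`: `c` if `b = 2 ^ c`, and
`⟨c⟩(n)`, computed in `f` stages, if `b = 3 * 5 ^ c`; `0` if the hint is wrong. -/
def down (b : ℕ) (w : ℕ × ℕ × ℕ) : ℕ :=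
  if 2 ^ w.1 = b then w.1
  else if 3 * 5 ^ w.1 = b then (pevaln w.2.2 w.1 w.2.1).getD 0
  else 0

/-- The result of a nonempty sequence of predecessor steps starting at `b`. -/
def descend (b : ℕ) (v : (ℕ × ℕ × ℕ) × List (ℕ × ℕ × ℕ)) : ℕ :=
  v.2.foldl down (down b v.1)

theorem down_two_pow_self (c : ℕ) : down (2 ^ c) (c, 0, 0) = c := by simp [down]

theorem down_lim {e n x f : ℕ} (h : pevaln f e n = some x) :
    down (3 * 5 ^ e) (e, n, f) = x := by
  simp [down, two_pow_ne_three_mul_five_pow, h]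

theorem down_two_pow (c : ℕ) (w : ℕ × ℕ × ℕ) : down (2 ^ c) w = c ∨ down (2 ^ c) w = 0 := by
  unfold down
  split_ifs with h1 h2
  · exact .inl (Nat.pow_right_injective le_rfl h1)
  · exact absurd h2.symm (two_pow_ne_three_mul_five_pow _ _)
  · exact .inr rfl

theorem down_three_mul_five_pow (e : ℕ) (w : ℕ × ℕ × ℕ) :
    (∃ n, down (3 * 5 ^ e) w ∈ peval e n) ∨ down (3 * 5 ^ e) w = 0 := by
  unfold down
  split_ifs with h1 h2
  · exact absurd h1 (two_pow_ne_three_mul_five_pow _ _)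
  · obtain rfl := three_mul_five_pow_inj h2
    cases hx : pevaln w.2.2 w.1 w.2.1 with
    | none => exact .inr rfl
    | some x => exact .inl ⟨w.2.1, mem_peval_iff.2 ⟨_, hx⟩⟩
  · exact .inr rfl

theorem down_zero (w : ℕ × ℕ × ℕ) : down 0 w = 0 := by
  simp [down]

theorem foldl_down_zero (l : List (ℕ × ℕ × ℕ)) : l.foldl down 0 = 0 := by
  induction l with
  | nil => rfl
  | cons w l ih => simpa [down_zero] using ih

/-- The inductive characterization of `O`, in which the fundamental sequences are only required
to increase along the recursively enumerable relation given by `descend`. -/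
inductive IsNotation : ℕ → Prop
  | one : IsNotation 1
  | step {a : ℕ} : IsNotation a → IsNotation (2 ^ a)
  | lim {e : ℕ} (u : ℕ → ℕ) (hu : ∀ n, u n ∈ peval e n) (h : ∀ n, IsNotation (u n))
      (hm : ∀ n, ∃ v, descend (u (n + 1)) v = u n) : IsNotation (3 * 5 ^ e)

theorem IsNotation.ne_zero {a : ℕ} (h : IsNotation a) : a ≠ 0 := by
  cases h <;> positivity

theorem KLt.isNotation {a b : ℕ} (h : KLt a b) :
    IsNotation a ∧ IsNotation b ∧ ∃ v, descend b v = a := by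
  induction h with
  | base => exact ⟨.one, .step .one, ((1, 0, 0), []), down_two_pow_self 1⟩
  | @step a b _ ih => exact ⟨ih.2.1, .step ih.2.1, ((b, 0, 0), []), down_two_pow_self b⟩
  | @lim e h _ n ih =>
    refine ⟨(ih n).1, .lim _ (fun n => Part.get_mem (h n)) (fun n => (ih n).1)
      (fun n => (ih n).2.2), ?_⟩
    obtain ⟨f, hf⟩ := mem_peval_iff.1 (Part.get_mem (h n))
    exact ⟨((e, n, f), []), down_lim hf⟩
  | trans _ _ ih₁ ih₂ =>
    obtain ⟨v₁, h₁⟩ := ih₁.2.2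
    obtain ⟨v₂, h₂⟩ := ih₂.2.2
    refine ⟨ih₁.1, ih₂.2.1, (v₂.1, v₂.2 ++ v₁.1 :: v₁.2), ?_⟩
    unfold descend at *
    simp [h₁, h₂]

theorem KLt.limit {e : ℕ} {u : ℕ → ℕ} (hu : ∀ n, u n ∈ peval e n)
    (hm : ∀ n, KLt (u n) (u (n + 1))) (n : ℕ) : KLt (u n) (3 * 5 ^ e) := by
  have hdom : ∀ n, (peval e n).Dom := fun n => (Part.dom_iff_mem).2 ⟨_, hu n⟩
  have hget : ∀ n, (peval e n).get (hdom n) = u n := fun n => Part.get_eq_of_mem (hu n) _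
  have := KLt.lim hdom (fun n => by simpa only [hget] using hm n) n
  rwa [hget] at this

/-- If every nonzero immediate predecessor of `b` lies below `b`, and `descend` is sound for each
of them, then `descend` is sound for `b`. -/
theorem descend_sound {b : ℕ}
    (h : ∀ w, down b w ≠ 0 → KLt (down b w) b ∧
      ∀ v, descend (down b w) v ≠ 0 → KLt (descend (down b w) v) (down b w))
    (v : (ℕ × ℕ × ℕ) × List (ℕ × ℕ × ℕ)) (hv : descend b v ≠ 0) : KLt (descend b v) b := by
  obtain ⟨w, l⟩ := v
  have hw : down b w ≠ 0 := fun h0 => hv (by simp [descend, h0, foldl_down_zero])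
  cases l with
  | nil => exact (h w hw).1
  | cons w' l => exact ((h w hw).2 (w', l) hv).trans (h w hw).1

theorem IsNotation.sound {b : ℕ} (h : IsNotation b) :
    KO b ∧ ∀ v, descend b v ≠ 0 → KLt (descend b v) b := by
  induction h with
  | one =>
    refine ⟨KLt.base, descend_sound fun w hw => absurd ?_ hw⟩
    simpa using down_two_pow 0 w
  | @step a _ ih =>
    refine ⟨KLt.step ih.1, descend_sound fun w hw => ?_⟩
    rw [(down_two_pow a w).resolve_right hw]
    exact ih
  | @lim e u hu h hm ih =>
    have hlt : ∀ n, KLt (u n) (u (n + 1)) := fun n => by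
      obtain ⟨v, hv⟩ := hm n
      rw [← hv]
      exact (ih (n + 1)).2 v (hv ▸ (h n).ne_zero)
    refine ⟨KLt.step (KLt.limit hu hlt 0), descend_sound fun w hw => ?_⟩
    obtain ⟨n, hn⟩ := (down_three_mul_five_pow e w).resolve_right hw
    rw [Part.mem_unique hn (hu n)]
    exact ⟨KLt.limit hu hlt n, (ih n).2⟩

theorem KO_iff_isNotation {a : ℕ} : KO a ↔ IsNotation a :=
  ⟨fun h => h.isNotation.1, fun h => h.sound.1⟩

/-! ### Primitive recursive well-founded trees as local codes -/

/-- `s` generates a well-founded tree, where `leaf` recognizes the leaves and all other nodes `s`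
have the children `child s n`. -/
inductive WFFrom {α : Type} (leaf : α → Bool) (child : α → ℕ → α) : α → Prop
  | leaf {s : α} (h : leaf s = true) : WFFrom leaf child s
  | node {s : α} (h : ∀ n, WFFrom leaf child (child s n)) : WFFrom leaf child s

/-- The sentence `0 = 0`. -/
def trivialSentence : Sentence := ⟨.eq .zero .zero, rfl⟩

/-- The sentence `∀x 0 = 0`. -/
def trivialAll : Sentence := sAll (.eq .zero .zero) rfl

/-- The sequent `0 = 0, ∀x 0 = 0`, which is an axiom and follows from itself by the `ω`-rule. -/
def trivialSequent : Finset Sentence := {trivialSentence, trivialAll}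

theorem isAxiom_trivialSequent : IsAxiom trivialSequent :=
  ⟨trivialSentence, by simp [trivialSequent], rfl, rfl⟩

theorem tup_injective : Function.Injective tup := fun _ _ h =>
  Encodable.encode_injective (Nat.succ_injective h)

theorem untup_tup (l : List ℕ) : untup (tup l) = l := by
  simp [untup, tup]

theorem decS_encS (Γ : Finset Sentence) : decS (encS Γ) = Γ := by
  simp [decS, encS]

theorem decF_encF (A : Sentence) : decF (encF A) = A := by
  simp [decF, encF]

/-- The local code of the axiom `trivialSequent`. -/
def leafCode : ℕ := tup [axC, encS trivialSequent]

/-- The local code deriving `trivialSequent` from itself by the `ω`-rule with index `e`. -/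
def nodeCode (e : ℕ) : ℕ := tup [omC, encS trivialSequent, encF trivialAll, e]

theorem EndS_leafCode : EndS leafCode = trivialSequent := by
  simp [EndS, leafCode, proj, untup_tup, decS_encS]

theorem EndS_nodeCode (e : ℕ) : EndS (nodeCode e) = trivialSequent := by
  simp only [EndS, nodeCode, proj, untup_tup, List.getD_cons_zero, List.getD_cons_succ, decS_encS,
    decF_encF]
  rw [if_neg (by decide)]
  simp [trivialSequent]

theorem CGen.mono_cut {c p r : Bool} {a : ℕ} (h : CGen c p r a) : CGen true p r a := by
  induction h with
  | ax Γ h => exact .ax Γ h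
  | and Γ A B _ _ ea eb iha ihb => exact .and Γ A B iha ihb ea eb
  | or Γ A B _ ea ih => exact .or Γ A B ih ea
  | om Γ A hA hp htot _ hend ih => exact .om Γ A hA hp htot ih hend
  | ex Γ A hA n _ ea ih => exact .ex Γ A hA n ih ea
  | cut _ Γ C _ _ ea eb iha ihb => exact .cut rfl Γ C iha ihb ea eb
  | omrep hr Γ hp htot _ hend ih => exact .omrep hr Γ hp htot ih hend

theorem CGen.nodeCode {c p r : Bool} {e : ℕ} {u : ℕ → ℕ} (hprim : Nat.Primrec u)
    (hu : ∀ n, peval e n = Part.some (u n)) (h : ∀ n, CGen c p r (u n))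
    (hend : ∀ n, EndS (u n) = trivialSequent) : CGen c p r (nodeCode e) := by
  have hdom : ∀ n, (peval e n).Dom := fun n => by rw [hu n]; trivial
  have hget : ∀ n, (peval e n).get (hdom n) = u n := fun n =>
    Part.get_eq_of_mem (by rw [hu n]; exact Part.mem_some _) _
  refine .om trivialSequent (.eq .zero .zero) rfl (fun _ => ⟨u, hprim, hu⟩) hdom
    (fun n => by rw [hget]; exact h n) (fun n => ?_)
  rw [hget, hend]
  symm
  rw [Finset.union_eq_left, Finset.singleton_subset_iff]
  exact Finset.mem_insert_self _ _

/-- Inversion of the `ω`-rule for the codes `nodeCode e`, in a form suited to induction. -/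
theorem CGen.induction_nodeCode {c p r : Bool} {P : ℕ → Prop}
    (hP : ∀ x, (∀ e, x = Shoen.nodeCode e → ∀ n y, y ∈ peval e n → P y) → P x) {x : ℕ}
    (h : CGen c p r x) : P x := by
  induction h with
  | om Γ A hA hp htot _ hend ih =>
    refine hP _ fun e he n y hy => ?_
    have := tup_injective he
    simp only [List.cons.injEq] at this
    obtain ⟨-, -, -, rfl, -⟩ := this
    rw [← Part.get_eq_of_mem hy (htot n)]
    exact ih n
  | _ =>
    refine hP _ fun e he => ?_
    have := tup_injective he
    simp [axC, andC, orC, omC, exC, cutC, omrepC] at this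

theorem primrec_nodeCode : Primrec nodeCode := by
  unfold nodeCode tup
  exact Primrec.succ.comp (Primrec.encode.comp
    (Primrec.list_cons.comp (.const _) (Primrec.list_cons.comp (.const _)
      (Primrec.list_cons.comp (.const _) (Primrec.list_cons.comp .id (.const _))))))

/-- Well-foundedness of primitive recursive trees is uniformly reducible to membership in
`C_prec` and `C_prec^-`. -/
theorem exists_primrec_reduction {α : Type} [Primcodable α] [Inhabited α] {leaf : α → Bool}
    {child : α → ℕ → α} (hleaf : Primrec leaf) (hchild : Primrec₂ child) :
    ∃ g : α → ℕ, Primrec g ∧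
      ∀ s, (WFFrom leaf child s → CprecM (g s)) ∧ (Cprec (g s) → WFFrom leaf child s) := by
  let G : Nat.Partrec.Code → α → ℕ := fun k s =>
    bif leaf s then leafCode
    else nodeCode (Encodable.encode (k.curry (Encodable.encode s)))
  have hG : Primrec₂ G :=
    Primrec.cond (hleaf.comp .snd) (.const _) (primrec_nodeCode.comp (Primrec.encode.comp
      (Nat.Partrec.Code.primrec₂_curry.comp .fst (Primrec.encode.comp .snd))))
  let st : ℕ → α := fun m => (Encodable.decode m).getD default
  have hst : Primrec st := Primrec.option_getD.comp Primrec.decode (.const _)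
  have hrec : Primrec₂ fun (k : Nat.Partrec.Code) (m : ℕ) =>
      G k (child (st m.unpair.1) m.unpair.2) :=
    hG.comp .fst (hchild.comp (hst.comp (Primrec.fst.comp (Primrec.unpair.comp .snd)))
      (Primrec.snd.comp (Primrec.unpair.comp .snd)))
  obtain ⟨k, hk⟩ := Nat.Partrec.Code.fixed_point₂
    (f := fun k m => Part.some (G k (child (st m.unpair.1) m.unpair.2))) hrec.to_comp.partrec₂
  have hGk : Primrec (G k) := hG.comp (.const k) .id
  have heval : ∀ s n, peval (Encodable.encode (k.curry (Encodable.encode s))) n =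
      Part.some (G k (child s n)) := fun s n => by
    simp [peval, Nat.Partrec.Code.eval_curry, hk, st]
  have hend : ∀ s, EndS (G k s) = trivialSequent := fun s => by
    cases hs : leaf s <;> simp [G, hs, EndS_leafCode, EndS_nodeCode]
  refine ⟨G k, hGk, fun s => ⟨fun h => ?_, fun h => ?_⟩⟩
  · induction h with
    | leaf h =>
      simp only [G, h, cond_true]
      exact .ax _ isAxiom_trivialSequent
    | @node s _ ih =>
      cases hs : leaf s
      · have : CprecM (nodeCode (Encodable.encode (k.curry (Encodable.encode s)))) :=
          CGen.nodeCode (Primrec.nat_iff.1 (hGk.comp (hchild.comp (.const s) .id)))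
            (heval s) ih (fun n => hend _)
        simpa only [G, hs, cond_false] using this
      · simp only [G, hs, cond_true]
        exact .ax _ isAxiom_trivialSequent
  · refine CGen.induction_nodeCode (P := fun x => ∀ s, x = G k s → WFFrom leaf child s)
      (fun x hx s hs => ?_) h s rfl
    cases hl : leaf s
    · refine .node fun n => ?_
      simp only [G, hl, cond_false] at hs
      refine hx _ hs n _ ?_ _ rfl
      rw [heval s n]
      exact Part.mem_some _
    · exact .leaf hl

/-! ### The tree of a notation -/

/-- Hints for `selectPred`. -/
abbrev Hint : Type := ℕ × ℕ × ℕ × (ℕ × ℕ × ℕ) × List (ℕ × ℕ × ℕ)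

/-- The hint coded by a natural number. -/
def hintOf (m : ℕ) : Hint := (Primcodable.toEncodable.decode m).getD (0, 0, 0, (0, 0, 0), [])

theorem hintOf_encode (w : Hint) : hintOf (Primcodable.toEncodable.encode w) = w := by
  rw [hintOf, Encodable.encodek, Option.getD_some]

theorem primrec_hintOf : Primrec hintOf :=
  Primrec.option_getD.comp Primrec.decode (.const _)

/-- The `n`-th member of the fundamental sequence of `a`, provided that the hint `(c, f, y, v)`
determines the shape of `a` and, in case `a = 3 * 5 ^ c`, witnesses that `⟨c⟩(n)` is defined and
lies below `⟨c⟩(n + 1) = y`. -/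
def selectPred (a n : ℕ) (w : Hint) : Option ℕ :=
  if 2 ^ w.1 = a then some w.1
  else if 3 * 5 ^ w.1 = a ∧ pevaln w.2.1 w.1 n = some (descend w.2.2.1 w.2.2.2) ∧
      pevaln w.2.1 w.1 (n + 1) = some w.2.2.1 then
    some (descend w.2.2.1 w.2.2.2)
  else none

theorem selectPred_two_pow (c n x : ℕ) :
    (∃ w, selectPred (2 ^ c) n w = some x) ↔ x = c := by
  constructor
  · rintro ⟨w, hw⟩
    unfold selectPred at hw
    split_ifs at hw with h1 h2
    · rw [← Option.some.inj hw]
      exact Nat.pow_right_injective le_rfl h1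
    · exact absurd h2.1.symm (two_pow_ne_three_mul_five_pow _ _)
  · rintro rfl
    exact ⟨(x, 0, 0, (0, 0, 0), []), by simp [selectPred]⟩

theorem selectPred_three_mul_five_pow (e n x : ℕ) :
    (∃ w, selectPred (3 * 5 ^ e) n w = some x) ↔
      x ∈ peval e n ∧ ∃ y ∈ peval e (n + 1), ∃ v, descend y v = x := by
  constructor
  · rintro ⟨w, hw⟩
    unfold selectPred at hw
    split_ifs at hw with h1 h2
    · exact absurd h1 (two_pow_ne_three_mul_five_pow _ _)
    · obtain ⟨h2, h3, h4⟩ := h2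
      obtain rfl := three_mul_five_pow_inj h2
      rw [hw] at h3
      exact ⟨mem_peval_iff.2 ⟨_, h3⟩, _, mem_peval_iff.2 ⟨_, h4⟩, _, Option.some.inj hw⟩
  · rintro ⟨hx, y, hy, v, rfl⟩
    obtain ⟨f₁, h₁⟩ := mem_peval_iff.1 hx
    obtain ⟨f₂, h₂⟩ := mem_peval_iff.1 hy
    refine ⟨(e, max f₁ f₂, y, v), ?_⟩
    unfold selectPred
    rw [if_neg (two_pow_ne_three_mul_five_pow _ _), if_pos
      ⟨rfl, pevaln_mono (le_max_left _ _) h₁, pevaln_mono (le_max_right _ _) h₂⟩]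

theorem selectPred_shape {a n x : ℕ} {w : Hint} (h : selectPred a n w = some x) :
    a = 2 ^ w.1 ∨ a = 3 * 5 ^ w.1 := by
  unfold selectPred at h
  split_ifs at h with h1 h2
  · exact .inl h1.symm
  · exact .inr h2.1.symm

/-- The leaves of the tree of notations: the state `(a, 0, _)` asserts `a ∈ O`. -/
def notationLeaf (s : ℕ × ℕ × ℕ) : Bool := decide (s.1 = 1 ∧ s.2.1 = 0)

/-- The children in the tree of notations: the state `(a, 0, _)` branches into the states
`(a, n + 1, 0)`, and `(a, n + 1, w)` searches through the hints from `w` on for the `n`-th member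
of the fundamental sequence of `a`. -/
def notationChild (s : ℕ × ℕ × ℕ) (k : ℕ) : ℕ × ℕ × ℕ :=
  if s.2.1 = 0 then (s.1, k + 1, 0)
  else Option.casesOn (selectPred s.1 (s.2.1 - 1) (hintOf s.2.2))
    (s.1, s.2.1, s.2.2 + 1) fun x => (x, 0, 0)

theorem notationChild_branch {s : ℕ × ℕ × ℕ} (h : s.2.1 = 0) (k : ℕ) :
    notationChild s k = (s.1, k + 1, 0) := if_pos h

theorem notationChild_none {s : ℕ × ℕ × ℕ} {n : ℕ} (h : s.2.1 = n + 1)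
    (hs : selectPred s.1 n (hintOf s.2.2) = none) (k : ℕ) :
    notationChild s k = (s.1, n + 1, s.2.2 + 1) := by
  unfold notationChild
  rw [h, Nat.add_sub_cancel, hs]
  rfl

theorem notationChild_some {s : ℕ × ℕ × ℕ} {n x : ℕ} (h : s.2.1 = n + 1)
    (hs : selectPred s.1 n (hintOf s.2.2) = some x) (k : ℕ) :
    notationChild s k = (x, 0, 0) := by
  unfold notationChild
  rw [h, Nat.add_sub_cancel, hs]
  rfl

theorem wfFrom_search {a n w : ℕ} {x : ℕ}
    (hx : selectPred a n (hintOf w) = some x)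
    (h : ∀ w x, selectPred a n w = some x → WFFrom notationLeaf notationChild (x, 0, 0)) :
    WFFrom notationLeaf notationChild (a, n + 1, 0) := by
  refine Nat.decreasingInduction (motive := fun v _ =>
    WFFrom notationLeaf notationChild (a, n + 1, v)) (fun v _ ih => .node fun k => ?_)
    (.node fun k => ?_) (Nat.zero_le w)
  · cases hv : selectPred a n (hintOf v) with
    | none =>
      rw [notationChild_none (s := (a, n + 1, v)) rfl hv k]
      exact ih
    | some y =>
      rw [notationChild_some (s := (a, n + 1, v)) rfl hv k]
      exact h _ _ hv
  · rw [notationChild_some (s := (a, n + 1, w)) rfl hx k]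
    exact h _ _ hx

theorem wfFrom_of_forall {a : ℕ} {u : ℕ → ℕ}
    (hu : ∀ n x, (∃ w, selectPred a n w = some x) ↔ x = u n)
    (h : ∀ n, WFFrom notationLeaf notationChild (u n, 0, 0)) :
    WFFrom notationLeaf notationChild (a, 0, 0) := by
  refine .node fun n => ?_
  obtain ⟨w, hw⟩ := (hu n _).2 rfl
  rw [← hintOf_encode w] at hw
  rw [notationChild_branch (s := (a, 0, 0)) rfl n]
  refine wfFrom_search hw fun v x hx => ?_
  rw [(hu n x).1 ⟨v, hx⟩]
  exact h n

theorem IsNotation.wfFrom {a : ℕ} (h : IsNotation a) :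
    WFFrom notationLeaf notationChild (a, 0, 0) := by
  induction h with
  | one => exact .leaf rfl
  | step _ ih => exact wfFrom_of_forall (fun n x => selectPred_two_pow _ n x) fun _ => ih
  | @lim e u hu _ hm ih =>
    refine wfFrom_of_forall (fun n x => ?_) ih
    rw [selectPred_three_mul_five_pow]
    constructor
    · exact fun hx => Part.mem_unique hx.1 (hu n)
    · rintro rfl
      exact ⟨hu n, _, hu (n + 1), hm n⟩

theorem isNotation_of_forall {a : ℕ}
    (h : ∀ n, ∃ w x, selectPred a n w = some x ∧ IsNotation x) : IsNotation a := by
  obtain ⟨w, x, hx, hn⟩ := h 0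
  rcases selectPred_shape hx with ha | ha
  · rw [ha] at hx ⊢
    rw [← (selectPred_two_pow _ _ _).1 ⟨w, hx⟩]
    exact hn.step
  · rw [ha] at h ⊢
    choose w u hu hn using h
    have key := fun n => (selectPred_three_mul_five_pow _ _ _).1 ⟨_, hu n⟩
    refine .lim u (fun n => (key n).1) hn fun n => ?_
    obtain ⟨y, hy, hv⟩ := (key n).2
    rwa [Part.mem_unique hy (key (n + 1)).1] at hv

theorem WFFrom.isNotation {s : ℕ × ℕ × ℕ} (h : WFFrom notationLeaf notationChild s) :
    (s.2.1 = 0 → IsNotation s.1) ∧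
      ∀ n, s.2.1 = n + 1 → ∃ w x, selectPred s.1 n w = some x ∧ IsNotation x := by
  induction h with
  | @leaf s h =>
    obtain ⟨h1, h2⟩ : s.1 = 1 ∧ s.2.1 = 0 := by simpa [notationLeaf] using h
    exact ⟨fun _ => h1 ▸ .one, fun n hn => by omega⟩
  | @node s _ ih =>
    refine ⟨fun h0 => isNotation_of_forall fun n => ?_, fun n hn => ?_⟩
    · have := (ih n).2 n
      rw [notationChild_branch h0] at this
      exact this rfl
    · cases hv : selectPred s.1 n (hintOf s.2.2) with
      | none =>
        have := (ih 0).2 n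
        rw [notationChild_none hn hv] at this
        exact this rfl
      | some x =>
        refine ⟨_, x, hv, ?_⟩
        have := (ih 0).1
        rw [notationChild_some hn hv] at this
        exact this rfl

theorem primrec_pow (b : ℕ) : Primrec fun n : ℕ => b ^ n :=
  (Primrec.nat_rec₁ 1 (f := fun _ m => m * b)
    (Primrec.nat_mul.comp Primrec.snd (.const b))).of_eq fun n => by
      induction n with
      | zero => rfl
      | succ n ih => simp [ih, pow_succ]

theorem primrec_pevaln {β : Type} [Primcodable β] {f e n : β → ℕ} (hf : Primrec f)
    (he : Primrec e) (hn : Primrec n) : Primrec fun s => pevaln (f s) (e s) (n s) :=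
  Nat.Partrec.Code.primrec_evaln.comp ((hf.pair ((Primrec.ofNat _).comp he)).pair hn)

theorem primrec_down : Primrec₂ down := by
  have hw : Primrec fun p : ℕ × ℕ × ℕ × ℕ => p.2.1 := Primrec.fst.comp .snd
  exact Primrec.ite (Primrec.eq.comp ((primrec_pow 2).comp hw) .fst) hw
    (Primrec.ite
      (Primrec.eq.comp (Primrec.nat_mul.comp (.const 3) ((primrec_pow 5).comp hw)) .fst)
      (Primrec.option_getD.comp (primrec_pevaln (Primrec.snd.comp (Primrec.snd.comp .snd)) hw
        (Primrec.fst.comp (Primrec.snd.comp .snd))) (.const 0)) (.const 0))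

theorem primrec_descend : Primrec₂ descend :=
  Primrec.list_foldl (h := fun _ q => down q.1 q.2) (Primrec.snd.comp .snd)
    (primrec_down.comp .fst (Primrec.fst.comp .snd))
    (primrec_down.comp (Primrec.fst.comp .snd) (Primrec.snd.comp .snd))

theorem primrec_selectPred {β : Type} [Primcodable β] {a n : β → ℕ} {w : β → Hint}
    (ha : Primrec a) (hn : Primrec n) (hw : Primrec w) :
    Primrec fun s => selectPred (a s) (n s) (w s) := by
  have hc : Primrec fun s => (w s).1 := Primrec.fst.comp hw
  have hf : Primrec fun s => (w s).2.1 := Primrec.fst.comp (Primrec.snd.comp hw)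
  have hy : Primrec fun s => (w s).2.2.1 :=
    Primrec.fst.comp (Primrec.snd.comp (Primrec.snd.comp hw))
  have hd : Primrec fun s => descend (w s).2.2.1 (w s).2.2.2 :=
    primrec_descend.comp hy (Primrec.snd.comp (Primrec.snd.comp (Primrec.snd.comp hw)))
  exact Primrec.ite (Primrec.eq.comp ((primrec_pow 2).comp hc) ha)
    (Primrec.option_some.comp hc)
    (Primrec.ite
      ((Primrec.eq.comp (Primrec.nat_mul.comp (.const 3) ((primrec_pow 5).comp hc)) ha).and
        ((Primrec.eq.comp (primrec_pevaln hf hc hn) (Primrec.option_some.comp hd)).and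
          (Primrec.eq.comp (primrec_pevaln hf hc (Primrec.succ.comp hn))
            (Primrec.option_some.comp hy))))
      (Primrec.option_some.comp hd) (.const none))

theorem primrec_notationLeaf : Primrec notationLeaf :=
  ((Primrec.eq.comp Primrec.fst (.const 1)).and
    (Primrec.eq.comp (Primrec.fst.comp .snd) (.const 0))).decide

theorem primrec_notationChild : Primrec₂ notationChild := by
  have ha : Primrec fun p : (ℕ × ℕ × ℕ) × ℕ => p.1.1 := Primrec.fst.comp .fst
  have hb : Primrec fun p : (ℕ × ℕ × ℕ) × ℕ => p.1.2.1 :=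
    Primrec.fst.comp (Primrec.snd.comp .fst)
  have hw : Primrec fun p : (ℕ × ℕ × ℕ) × ℕ => p.1.2.2 :=
    Primrec.snd.comp (Primrec.snd.comp .fst)
  have hs : Primrec fun p : (ℕ × ℕ × ℕ) × ℕ =>
      selectPred p.1.1 (p.1.2.1 - 1) (hintOf p.1.2.2) :=
    primrec_selectPred ha (Primrec.nat_sub.comp hb (.const 1)) (primrec_hintOf.comp hw)
  have hx : Primrec₂ fun (_ : (ℕ × ℕ × ℕ) × ℕ) (x : ℕ) => ((x, 0, 0) : ℕ × ℕ × ℕ) :=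
    Primrec.pair Primrec.snd (Primrec.pair (.const 0) (.const 0))
  have hc := Primrec.option_casesOn hs (ha.pair (hb.pair (Primrec.succ.comp hw))) hx
  have hi := ha.pair ((Primrec.succ.comp Primrec.snd).pair (.const 0))
  exact (Primrec.ite (Primrec.eq.comp hb (.const 0)) hi hc).of_eq fun p => by
    rw [notationChild]

/-- **`Π¹₁`-hardness of `C_prec` and `C_prec^-`.**  There is a primitive
recursive `g` with `a ∈ O ↔ g(a) ∈ C_prec` and `a ∈ O ↔ g(a) ∈ C_prec^-`;
hence Kleene's `O` is many-one reducible to `C_prec` and to `C_prec^-`. -/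
theorem cprec_pi11_hard :
    ∃ g : ℕ → ℕ, Nat.Primrec g ∧
      (∀ a : ℕ, KO a ↔ Cprec (g a)) ∧
      (∀ a : ℕ, KO a ↔ CprecM (g a)) := by
  obtain ⟨g, hg, h⟩ := exists_primrec_reduction primrec_notationLeaf primrec_notationChild
  have hinit : Primrec fun a : ℕ => g (a, 0, 0) :=
    hg.comp (Primrec.pair .id (Primrec.pair (.const 0) (.const 0)))
  refine ⟨fun a => g (a, 0, 0), Primrec.nat_iff.1 hinit, fun a => ?_, fun a => ?_⟩
  · rw [KO_iff_isNotation]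
    exact ⟨fun ha => ((h _).1 ha.wfFrom).mono_cut, fun ha => ((h _).2 ha).isNotation.1 rfl⟩
  · rw [KO_iff_isNotation]
    exact ⟨fun ha => (h _).1 ha.wfFrom, fun ha => ((h _).2 ha.mono_cut).isNotation.1 rfl⟩

end Shoen
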